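/- Totality of the big-step duration semantics: for every closed HybCore computation term p, precisely one of the following holds: either there exists d ∈ [0,∞] such that the divergence judgement p ⇓ d is derivable, or there exist d ∈ [0,∞) and a closed value v such that the termination judgement p ⇓ d, v is derivable. -/

import Mathlib

set_option autoImplicit false

open scoped NNReal ENNReal

/-! ### HybCore types and signatures -/

inductive Ty : Type where
  | nat : Ty
  | real : Ty
  | unit : Ty
  | bool : Ty
  | prod : Ty → Ty → Ty

/-- Denotation of types. -/
def Ty.den : Ty → Type
  | .nat => ℕ
  | .real => ℝ
  | .unit => Unit
  | .bool => Bool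
  | .prod A B => A.den × B.den

inductive BaseTy : Type where
  | nat : BaseTy
  | real : BaseTy
  | bool : BaseTy

def BaseTy.toTy : BaseTy → Ty
  | .nat => .nat
  | .real => .real
  | .bool => .bool

/-- A signature of typed operation symbols `f : A → B` with `B ∈ {ℕ, ℝ, 2}`,
together with their interpretation as functions between the denoted sets. -/
structure Signature : Type 1 where
  Op : Type
  dom : Op → Ty
  cod : Op → BaseTy
  interp : (f : Op) → (dom f).den → ((cod f).toTy).den

/-! ### Terms -/

abbrev Ctx := List Ty

inductive Var : Ctx → Ty → Type where
  | here {Γ : Ctx} {A : Ty} : Var (A :: Γ) A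
  | there {Γ : Ctx} {A B : Ty} : Var Γ A → Var (B :: Γ) A

/-- Value terms in context (a constant is included for each real number, so
that time instants can be substituted for variables of type `ℝ`). -/
inductive Val (σ : Signature) : Ctx → Ty → Type where
  | var {Γ : Ctx} {A : Ty} : Var Γ A → Val σ Γ A
  | star {Γ : Ctx} : Val σ Γ .unit
  | tt {Γ : Ctx} : Val σ Γ .bool
  | ff {Γ : Ctx} : Val σ Γ .bool
  | realC {Γ : Ctx} : ℝ → Val σ Γ .real
  | pair {Γ : Ctx} {A B : Ty} : Val σ Γ A → Val σ Γ B → Val σ Γ (.prod A B)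
  | app {Γ : Ctx} (f : σ.Op) : Val σ Γ (σ.dom f) → Val σ Γ ((σ.cod f).toTy)

/-- Computation terms in context: `now v`, pattern matching, if-then-else,
sequencing, while-loops and trajectory abstraction. -/
inductive Comp (σ : Signature) : Ctx → Ty → Type where
  | now {Γ : Ctx} {A : Ty} : Val σ Γ A → Comp σ Γ A
  | pm {Γ : Ctx} {A B C : Ty} :
      Val σ Γ (.prod A B) → Comp σ (A :: B :: Γ) C → Comp σ Γ C
  | cond {Γ : Ctx} {A : Ty} : Val σ Γ .bool → Comp σ Γ A → Comp σ Γ A → Comp σ Γ A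
  | seq {Γ : Ctx} {A B : Ty} : Comp σ Γ A → Comp σ (A :: Γ) B → Comp σ Γ B
  | wh {Γ : Ctx} {A : Ty} :
      Comp σ Γ A → Val σ (A :: Γ) .bool → Comp σ (A :: Γ) A → Comp σ Γ A
  | traj {Γ : Ctx} {A : Ty} :
      Val σ (.real :: Γ) A → Val σ (A :: Γ) .bool → Comp σ Γ A

/-! ### Substitution of closed values -/

def Var.remove : {Γ : Ctx} → {A : Ty} → Var Γ A → Ctx
  | _ :: Γ, _, .here => Γ
  | B :: _, _, .there x => B :: Var.remove x

def weakenVal {σ : Signature} {Γ : Ctx} : {A : Ty} → Val σ [] A → Val σ Γ A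
  | _, .var x => nomatch x
  | _, .star => .star
  | _, .tt => .tt
  | _, .ff => .ff
  | _, .realC r => .realC r
  | _, .pair a b => .pair (weakenVal a) (weakenVal b)
  | _, .app f a => .app f (weakenVal a)

def Var.compare : {Γ : Ctx} → {A B : Ty} → (x : Var Γ A) → (y : Var Γ B) →
    PSum (B = A) (Var x.remove B)
  | _, _, _, .here, .here => .inl rfl
  | _, _, _, .here, .there y' => .inr y'
  | _, _, _, .there _, .here => .inr .here
  | _, _, _, .there x', .there y' =>
      match Var.compare x' y' with
      | .inl h => .inl h
      | .inr z => .inr (.there z)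

/-- Substitution of a closed value for a variable in a value term. -/
def substVal {σ : Signature} {A : Ty} (v : Val σ [] A) :
    {Γ : Ctx} → {B : Ty} → Val σ Γ B → (x : Var Γ A) → Val σ x.remove B
  | _, _, .var y, x =>
      match Var.compare x y with
      | .inl rfl => weakenVal v
      | .inr z => .var z
  | _, _, .star, _ => .star
  | _, _, .tt, _ => .tt
  | _, _, .ff, _ => .ff
  | _, _, .realC r, _ => .realC r
  | _, _, .pair a b, x => .pair (substVal v a x) (substVal v b x)
  | _, _, .app f a, x => .app f (substVal v a x)

/-- Substitution of a closed value for a variable in a computation term. -/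
def substComp {σ : Signature} {A : Ty} (v : Val σ [] A) :
    {Γ : Ctx} → {B : Ty} → Comp σ Γ B → (x : Var Γ A) → Comp σ x.remove B
  | _, _, .now w, x => .now (substVal v w x)
  | _, _, .pm w k, x => .pm (substVal v w x) (substComp v k (.there (.there x)))
  | _, _, .cond b p q, x => .cond (substVal v b x) (substComp v p x) (substComp v q x)
  | _, _, .seq p q, x => .seq (substComp v p x) (substComp v q (.there x))
  | _, _, .wh p b q, x =>
      .wh (substComp v p x) (substVal v b (.there x)) (substComp v q (.there x))
  | _, _, .traj h b, x => .traj (substVal v h (.there x)) (substVal v b (.there x))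

/-- `q[v/x]` for the head variable. -/
def Comp.inst {σ : Signature} {Γ : Ctx} {A B : Ty}
    (q : Comp σ (A :: Γ) B) (v : Val σ [] A) : Comp σ Γ B :=
  substComp v q .here

def Val.inst {σ : Signature} {Γ : Ctx} {A B : Ty}
    (w : Val σ (A :: Γ) B) (v : Val σ [] A) : Val σ Γ B :=
  substVal v w .here

/-- `p[v/x, w/y]` for pattern matching. -/
def Comp.inst2 {σ : Signature} {Γ : Ctx} {A B C : Ty}
    (k : Comp σ (A :: B :: Γ) C) (va : Val σ [] A) (vb : Val σ [] B) : Comp σ Γ C :=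
  (k.inst va).inst vb

/-! ### Denotation of values -/

def Env : Ctx → Type
  | [] => Unit
  | A :: Γ => A.den × Env Γ

def Var.lookup : {Γ : Ctx} → {A : Ty} → Var Γ A → Env Γ → A.den
  | _, _, .here, ρ => ρ.1
  | _, _, .there x, ρ => Var.lookup x ρ.2

def Val.den {σ : Signature} : {Γ : Ctx} → {A : Ty} → Val σ Γ A → Env Γ → A.den
  | _, _, .var x, ρ => x.lookup ρ
  | _, _, .star, _ => ()
  | _, _, .tt, _ => true
  | _, _, .ff, _ => false
  | _, _, .realC r, _ => r
  | _, _, .pair a b, ρ => (a.den ρ, b.den ρ)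
  | _, _, .app f a, ρ => σ.interp f (a.den ρ)

/-! ### Trajectory abstraction: duration and guard -/

/-- The (boolean denotation of the) guard `w[v[s/t]/x]` of a trajectory
abstraction `(x := t.v) & w` at time instant `s`. -/
def trajGuard {σ : Signature} {A : Ty}
    (h : Val σ [Ty.real] A) (b : Val σ [A] Ty.bool) (s : ℝ) : Bool :=
  (b.inst (h.inst (.realC s))).den ()

/-- The duration `sup {e ∣ ∀ s ∈ [0,e], w[v[s/t]/x] = true}` of a trajectory
abstraction `(x := t.v) & w`. -/
noncomputable def trajDur {σ : Signature} {A : Ty}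
    (h : Val σ [Ty.real] A) (b : Val σ [A] Ty.bool) : ℝ≥0∞ :=
  sSup {e : ℝ≥0∞ | ∀ s : ℝ≥0, (s : ℝ≥0∞) ≤ e → trajGuard h b (s : ℝ) = true}

/-- A trajectory abstraction terminates iff its duration `d` is finite and the
guard holds at `d`. -/
noncomputable def trajStops {σ : Signature} {A : Ty}
    (h : Val σ [Ty.real] A) (b : Val σ [A] Ty.bool) : Prop :=
  ∃ d : ℝ≥0, trajDur h b = (d : ℝ≥0∞) ∧ trajGuard h b (d : ℝ) = true

/-! ### Big-step duration semantics (Figure 3) -/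

mutual
  /-- `p ⇓ d` : divergence in time `d ∈ [0,∞]`. -/
  inductive BigDiv {σ : Signature} : {A : Ty} → Comp σ [] A → ℝ≥0∞ → Prop where
    | pm {A B C : Ty} {v : Val σ [] A} {w : Val σ [] B} {k : Comp σ [A, B] C} {d : ℝ≥0∞} :
        BigDiv (k.inst2 v w) d → BigDiv (.pm (.pair v w) k) d
    | condT {A : Ty} {v : Val σ [] .bool} {p q : Comp σ [] A} {d : ℝ≥0∞} :
        v.den () = true → BigDiv p d → BigDiv (.cond v p q) d
    | condF {A : Ty} {v : Val σ [] .bool} {p q : Comp σ [] A} {d : ℝ≥0∞} :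
        v.den () = false → BigDiv q d → BigDiv (.cond v p q) d
    | seq1 {A B : Ty} {p : Comp σ [] A} {q : Comp σ [A] B} {d : ℝ≥0∞} :
        BigDiv p d → BigDiv (p.seq q) d
    | seq2 {A B : Ty} {p : Comp σ [] A} {q : Comp σ [A] B}
        {d : ℝ≥0} {v : Val σ [] A} {e : ℝ≥0∞} :
        BigConv p d v → BigDiv (q.inst v) e → BigDiv (p.seq q) ((d : ℝ≥0∞) + e)
    | traj {A : Ty} {h : Val σ [Ty.real] A} {b : Val σ [A] Ty.bool} :
        ¬ trajStops h b → BigDiv (.traj h b) (trajDur h b)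
    | wh1 {A : Ty} {p : Comp σ [] A} {b : Val σ [A] Ty.bool} {q : Comp σ [A] A} {d : ℝ≥0∞} :
        BigDiv p d → BigDiv (.wh p b q) d
    | wh3 {A : Ty} {p : Comp σ [] A} {b : Val σ [A] Ty.bool} {q : Comp σ [A] A}
        {d : ℝ≥0} {w : Val σ [] A} {r : ℝ≥0∞} :
        BigConv p d w → (b.inst w).den () = true →
        BigDiv (Comp.wh (q.inst w) b q) r → BigDiv (.wh p b q) ((d : ℝ≥0∞) + r)
    | wh5 {A : Ty} {p : Comp σ [] A} {b : Val σ [A] Ty.bool} {q : Comp σ [A] A}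
        (ws : ℕ → Val σ [] A) (ds : ℕ → ℝ≥0) :
        BigConv p (ds 0) (ws 0) →
        (∀ i : ℕ, (b.inst (ws i)).den () = true) →
        (∀ i : ℕ, BigConv (q.inst (ws i)) (ds (i + 1)) (ws (i + 1))) →
        BigDiv (.wh p b q) (∑' i : ℕ, (ds i : ℝ≥0∞))

  /-- `p ⇓ d, v` : termination with closed value `v` in time `d ∈ [0,∞)`. -/
  inductive BigConv {σ : Signature} : {A : Ty} → Comp σ [] A → ℝ≥0 → Val σ [] A → Prop where
    | now {A : Ty} {v : Val σ [] A} : BigConv (.now v) 0 v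
    | pm {A B C : Ty} {v : Val σ [] A} {w : Val σ [] B} {k : Comp σ [A, B] C}
        {d : ℝ≥0} {u : Val σ [] C} :
        BigConv (k.inst2 v w) d u → BigConv (.pm (.pair v w) k) d u
    | condT {A : Ty} {v : Val σ [] .bool} {p q : Comp σ [] A} {d : ℝ≥0} {u : Val σ [] A} :
        v.den () = true → BigConv p d u → BigConv (.cond v p q) d u
    | condF {A : Ty} {v : Val σ [] .bool} {p q : Comp σ [] A} {d : ℝ≥0} {u : Val σ [] A} :
        v.den () = false → BigConv q d u → BigConv (.cond v p q) d u
    | seq {A B : Ty} {p : Comp σ [] A} {q : Comp σ [A] B}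
        {d e : ℝ≥0} {v : Val σ [] A} {w : Val σ [] B} :
        BigConv p d v → BigConv (q.inst v) e w → BigConv (p.seq q) (d + e) w
    | traj {A : Ty} {h : Val σ [Ty.real] A} {b : Val σ [A] Ty.bool} {d : ℝ≥0} :
        trajDur h b = (d : ℝ≥0∞) → trajGuard h b (d : ℝ) = true →
        BigConv (.traj h b) d (h.inst (.realC (d : ℝ)))
    | wh2 {A : Ty} {p : Comp σ [] A} {b : Val σ [A] Ty.bool} {q : Comp σ [A] A}
        {d : ℝ≥0} {w : Val σ [] A} :
        BigConv p d w → (b.inst w).den () = false → BigConv (.wh p b q) d w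
    | wh4 {A : Ty} {p : Comp σ [] A} {b : Val σ [A] Ty.bool} {q : Comp σ [A] A}
        {d r : ℝ≥0} {w u : Val σ [] A} :
        BigConv p d w → (b.inst w).den () = true →
        BigConv (Comp.wh (q.inst w) b q) r u → BigConv (.wh p b q) (d + r) u
end

def Comp.sz {σ : Signature} : {Γ : Ctx} → {A : Ty} → Comp σ Γ A → ℕ
  | _, _, .now _ => 1
  | _, _, .pm _ k => k.sz + 1
  | _, _, .cond _ p q => p.sz + q.sz + 1
  | _, _, .seq p q => p.sz + q.sz + 1
  | _, _, .wh p _ q => p.sz + q.sz + 1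
  | _, _, .traj _ _ => 1

theorem sz_subst {σ : Signature} {A : Ty} (v : Val σ [] A) {Γ : Ctx} {B : Ty}
    (p : Comp σ Γ B) : ∀ (x : Var Γ A), (substComp v p x).sz = p.sz := by
  induction p with
  | now w => intro x; rfl
  | traj h b => intro x; rfl
  | pm w k ih => intro x; exact congrArg (· + 1) (ih (.there (.there x)))
  | cond b p q ih1 ih2 =>
    intro x; exact congrArg (· + 1) (congrArg₂ (· + ·) (ih1 x) (ih2 x))
  | seq p q ih1 ih2 =>
    intro x; exact congrArg (· + 1) (congrArg₂ (· + ·) (ih1 x) (ih2 (.there x)))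
  | wh p b q ih1 ih2 =>
    intro x; exact congrArg (· + 1) (congrArg₂ (· + ·) (ih1 x) (ih2 (.there x)))

theorem sz_inst {σ : Signature} {A B : Ty} {Γ : Ctx} (p : Comp σ (A :: Γ) B)
    (v : Val σ [] A) : (p.inst v).sz = p.sz := sz_subst v p .here

theorem closed_pair_aux {σ : Signature} {Γ : Ctx} {C : Ty} (v : Val σ Γ C) :
    Γ = [] → ∀ (A B : Ty) (h : C = .prod A B), ∃ a b, h ▸ v = Val.pair a b := by
  cases v with
  | var x => rintro rfl; cases x
  | app f a =>
    intro _ A B h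
    exfalso
    cases hc : σ.cod f <;> rw [hc] at h <;> cases h
  | pair a b => rintro rfl A B h; cases h; exact ⟨a, b, rfl⟩
  | _ => intro _ A B h; cases h

theorem closed_pair {σ : Signature} {A B : Ty} (v : Val σ [] (.prod A B)) :
    ∃ a b, v = Val.pair a b := closed_pair_aux v rfl A B rfl

def Tot {σ : Signature} {A : Ty} (p : Comp σ [] A) : Prop :=
  (∃ d : ℝ≥0∞, BigDiv p d) ∨ (∃ (d : ℝ≥0) (v : Val σ [] A), BigConv p d v)

theorem tot_wh {σ : Signature} {A : Ty} {p : Comp σ [] A} {b : Val σ [A] Ty.bool}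
    {q : Comp σ [A] A} (hp : Tot p) (hq : ∀ w, Tot (q.inst w)) : Tot (.wh p b q) := by
  by_contra hn
  have step : ∀ p' : Comp σ [] A, Tot p' → ¬ Tot (.wh p' b q) →
      ∃ (x : ℝ≥0 × Val σ [] A), BigConv p' x.1 x.2 ∧ (b.inst x.2).den () = true ∧
        ¬ Tot (.wh (q.inst x.2) b q) := by
    intro p' h1 h2
    rcases h1 with ⟨d, h⟩ | ⟨d, w, h⟩
    · exact absurd (Or.inl ⟨d, .wh1 h⟩) h2
    · cases hb : ((b.inst w).den () : Bool) with
      | false => exact absurd (Or.inr ⟨d, w, .wh2 h hb⟩) h2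
      | true =>
        refine ⟨(d, w), h, hb, ?_⟩
        rintro (⟨e, he⟩ | ⟨e, u, he⟩)
        · exact h2 (Or.inl ⟨_, .wh3 h hb he⟩)
        · exact h2 (Or.inr ⟨_, u, .wh4 h hb he⟩)
  obtain ⟨x0, h0, g0, n0⟩ := step p hp hn
  let S := {x : ℝ≥0 × Val σ [] A //
    (b.inst x.2).den () = true ∧ ¬ Tot (.wh (q.inst x.2) b q)}
  have nxt : ∀ x : S, ∃ y : S, BigConv (q.inst x.1.2) y.1.1 y.1.2 := by
    intro x
    obtain ⟨y, h, g, n⟩ := step _ (hq x.1.2) x.2.2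
    exact ⟨⟨y, g, n⟩, h⟩
  choose f hf using nxt
  let s : ℕ → S := fun n => Nat.rec ⟨x0, g0, n0⟩ (fun _ x => f x) n
  exact hn (Or.inl ⟨_, .wh5 (fun i => (s i).1.2) (fun i => (s i).1.1) h0
    (fun i => (s i).2.1) (fun i => hf (s i))⟩)

theorem tot_all {σ : Signature} (n : ℕ) : ∀ {A : Ty} (p : Comp σ [] A), p.sz ≤ n → Tot p := by
  induction n with
  | zero => intro A p h; cases p <;> simp [Comp.sz] at h
  | succ n ih =>
    intro A p h
    cases p with
    | now v => exact Or.inr ⟨_, _, .now⟩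
    | pm v k =>
      obtain ⟨a, b, rfl⟩ := closed_pair v
      have : (k.inst2 a b).sz ≤ n := by
        simp only [Comp.inst2, sz_inst, Comp.sz] at *; omega
      rcases ih _ this with ⟨d, h⟩ | ⟨d, w, h⟩
      · exact Or.inl ⟨_, .pm h⟩
      · exact Or.inr ⟨_, _, .pm h⟩
    | cond v p q =>
      simp only [Comp.sz] at h
      cases hb : (v.den () : Bool) with
      | true =>
        rcases ih p (by omega) with ⟨d, h⟩ | ⟨d, w, h⟩
        · exact Or.inl ⟨_, .condT hb h⟩
        · exact Or.inr ⟨_, _, .condT hb h⟩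
      | false =>
        rcases ih q (by omega) with ⟨d, h⟩ | ⟨d, w, h⟩
        · exact Or.inl ⟨_, .condF hb h⟩
        · exact Or.inr ⟨_, _, .condF hb h⟩
    | seq p q =>
      simp only [Comp.sz] at h
      rcases ih p (by omega) with ⟨d, h1⟩ | ⟨d, w, h1⟩
      · exact Or.inl ⟨_, .seq1 h1⟩
      · rcases ih (q.inst w) (by rw [sz_inst]; omega) with ⟨e, h2⟩ | ⟨e, u, h2⟩
        · exact Or.inl ⟨_, .seq2 h1 h2⟩
        · exact Or.inr ⟨_, _, .seq h1 h2⟩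
    | wh p b q =>
      simp only [Comp.sz] at h
      exact tot_wh (ih p (by omega)) (fun w => ih _ (by rw [sz_inst]; omega))
    | traj v b =>
      by_cases hs : trajStops v b
      · obtain ⟨d, h1, h2⟩ := hs
        exact Or.inr ⟨_, _, .traj h1 h2⟩
      · exact Or.inl ⟨_, .traj hs⟩

theorem conv_unique {σ : Signature} {A : Ty} {p : Comp σ [] A} {d : ℝ≥0} {v : Val σ [] A}
    (H : BigConv p d v) :
    (∀ d' v', BigConv p d' v' → v' = v) ∧ ∀ e, ¬ BigDiv p e := by
  refine BigConv.rec (motive_1 := fun {A} p e _ => True)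
    (motive_2 := fun {A} p d v _ => (∀ d' v', BigConv p d' v' → v' = v) ∧ ∀ e, ¬ BigDiv p e)
    ?_ ?_ ?_ ?_ ?_ ?_ ?_ ?_ ?_ ?_ ?_ ?_ ?_ ?_ ?_ ?_ ?_ H
  iterate 9 (intros; trivial)
  · intro A v
    refine ⟨fun d' v' h => ?_, fun e h => ?_⟩
    · cases h; rfl
    · cases h
  · intro A B C v w k d u _ ih
    refine ⟨fun d' v' h => ?_, fun e h => ?_⟩
    · cases h with | pm h => exact ih.1 _ _ h
    · cases h with | pm h => exact ih.2 _ h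
  · intro A v p q d u hb _ ih
    refine ⟨fun d' v' h => ?_, fun e h => ?_⟩
    · cases h with
      | condT _ h => exact ih.1 _ _ h
      | condF hb' h => exact absurd (hb.symm.trans hb') Bool.noConfusion
    · cases h with
      | condT _ h => exact ih.2 _ h
      | condF hb' h => exact absurd (hb.symm.trans hb') Bool.noConfusion
  · intro A v p q d u hb _ ih
    refine ⟨fun d' v' h => ?_, fun e h => ?_⟩
    · cases h with
      | condF _ h => exact ih.1 _ _ h
      | condT hb' h => exact absurd (hb.symm.trans hb') Bool.noConfusion
    · cases h with
      | condF _ h => exact ih.2 _ h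
      | condT hb' h => exact absurd (hb.symm.trans hb') Bool.noConfusion
  · intro A B p q d e v w _ _ ih1 ih2
    refine ⟨fun d' v' h => ?_, fun e h => ?_⟩
    · cases h with
      | seq h1 h2 => cases ih1.1 _ _ h1; exact ih2.1 _ _ h2
    · cases h with
      | seq1 h => exact ih1.2 _ h
      | seq2 h1 h2 => cases ih1.1 _ _ h1; exact ih2.2 _ h2
  · intro A v b d hd hg
    refine ⟨fun d' v' h => ?_, fun e h => ?_⟩
    · cases h with
      | traj h1 h2 =>
        have := ENNReal.coe_injective (h1.symm.trans hd)
        rw [this]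
    · cases h with
      | traj h => exact h ⟨d, hd, hg⟩
  · intro A p b q d w _ hb ih
    refine ⟨fun d' v' h => ?_, fun e h => ?_⟩
    · cases h with
      | wh2 h _ => exact ih.1 _ _ h
      | wh4 h hb' _ =>
        cases ih.1 _ _ h
        exact absurd (hb.symm.trans hb') Bool.noConfusion
    · cases h with
      | wh1 h => exact ih.2 _ h
      | wh3 h hb' _ =>
        cases ih.1 _ _ h
        exact absurd (hb.symm.trans hb') Bool.noConfusion
      | wh5 ws ds h hb' _ =>
        have hw := ih.1 _ _ h
        have := hb' 0
        rw [hw] at this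
        exact absurd (hb.symm.trans this) Bool.noConfusion
  · intro A p b q d r w u _ hb _ ih1 ih2
    refine ⟨fun d' v' h => ?_, fun e h => ?_⟩
    · cases h with
      | wh2 h hb' =>
        cases ih1.1 _ _ h
        exact absurd (hb.symm.trans hb') Bool.noConfusion
      | wh4 h hb' h2 =>
        cases ih1.1 _ _ h
        exact ih2.1 _ _ h2
    · cases h with
      | wh1 h => exact ih1.2 _ h
      | wh3 h hb' h2 =>
        cases ih1.1 _ _ h
        exact ih2.2 _ h2
      | wh5 ws ds h hb' hs =>
        have hw := ih1.1 _ _ h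
        refine ih2.2 _ (.wh5 (fun i => ws (i + 1)) (fun i => ds (i + 1)) ?_
          (fun i => hb' (i + 1)) (fun i => hs (i + 1)))
        rw [← hw]
        exact hs 0

/-- **Totality of the big-step duration semantics** (Corollary 4.9): for every
closed HybCore computation term `p`, precisely one of the following holds:
either `p ⇓ d` is derivable for some `d ∈ [0,∞]`, or `p ⇓ d, v` is derivable
for some `d ∈ [0,∞)` and closed value `v`. -/
theorem bigstep_totality {σ : Signature} {A : Ty} (p : Comp σ [] A) :
    Xor' (∃ d : ℝ≥0∞, BigDiv p d)
         (∃ (d : ℝ≥0) (v : Val σ [] A), BigConv p d v) := by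
  rcases tot_all _ p le_rfl with h | ⟨d, v, h⟩
  · exact Or.inl ⟨h, fun ⟨_, _, h2⟩ => h.elim fun e he => (conv_unique h2).2 e he⟩
  · exact Or.inr ⟨⟨d, v, h⟩, fun ⟨e, he⟩ => (conv_unique h).2 e he⟩
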